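/- Let m ≥ 2, let d ∈ V, and set ε = −1 if Tr(ϑ_0(d)) = 0 and ε = +1 if Tr(ϑ_0(d)) = 1 (so ϑ_d has type −ε). The simple graph whose vertex set is {a ∈ V : Tr(ϑ_d(a)) = 1}, with distinct vertices a, b adjacent if and only if ϑ_d(a+b) = ⟨a,b⟩², is strongly regular with parameters v = q^m(q^m + ε)/2, k = (q^{m−1} + ε)(q^m − ε), λ = 2(q^{2m−2} − 1) + ε·q^{m−1}(q − 1), μ = 2q^{m−1}(q^{m−1} + ε). (This graph is isomorphic to NO^ε(2m+1,q), the graph on the non-singular hyperplanes of type ε of a parabolic quadric Q(2m,q), two hyperplanes adjacent when they meet the quadric in a degenerate section.) -/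

import Mathlib

open Finset

noncomputable section

/-- The symplectic bilinear form `⟨u,v⟩ = ∑_{i<m} (u_i v_{m+i} + u_{m+i} v_i)` on `F^{2m}`,
`F = GF(2^h)`. -/
def symp (h m : ℕ) (u v : Fin (2*m) → GaloisField 2 h) : GaloisField 2 h :=
  ∑ i : Fin m, (u ⟨i.1, by omega⟩ * v ⟨m + i.1, by omega⟩ +
    u ⟨m + i.1, by omega⟩ * v ⟨i.1, by omega⟩)

/-- The quadratic form `ϑ_0(u) = ∑_{i<m} u_i u_{m+i}`. -/
def th0 (h m : ℕ) (u : Fin (2*m) → GaloisField 2 h) : GaloisField 2 h :=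
  ∑ i : Fin m, u ⟨i.1, by omega⟩ * u ⟨m + i.1, by omega⟩

/-- The quadratic form `ϑ_a(u) = ϑ_0(u) + ⟨a,u⟩²`. -/
def th (h m : ℕ) (a u : Fin (2*m) → GaloisField 2 h) : GaloisField 2 h :=
  th0 h m u + (symp h m a u)^2

/-- The absolute trace `GF(2^h) → F_2`. -/
def tr (h : ℕ) (x : GaloisField 2 h) : ZMod 2 :=
  Algebra.trace (ZMod 2) (GaloisField 2 h) x

end

section QuadraticFormCounting

variable {K V : Type*} [Field K] [Fintype K] [DecidableEq K] [AddCommGroup V] [Module K V]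
  [Fintype V]

lemma card_mul_card_fiber_of_linear (f : V →ₗ[K] K) (hf : f ≠ 0) (α : K) :
    Fintype.card K * #{x | f x = α} = Fintype.card V := by
  have hs : Function.Surjective f := LinearMap.surjective hf
  have hfib (β : K) : #{x | f x = β} = #{x | f x = α} :=
    AddMonoidHom.card_fiber_eq_of_mem_range f.toAddMonoidHom (hs β) (hs α)
  have := Finset.card_eq_sum_card_fiberwise (f := f) (s := univ) (t := univ) (by simp)
  simp only [hfib, sum_const, smul_eq_mul, card_univ] at this
  exact this.symm

/-- If every translate by the line spanned by `g` inside `{polar Q g = α}` contains exactly one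
singular vector, the singular vectors make up the fraction `1 / |K|` of that set. -/
lemma card_mul_card_singular_of_line (Q : QuadraticForm K V) (g : V) (α : K)
    (hgg : QuadraticMap.polar Q g g = 0)
    (huniq : ∀ x, QuadraticMap.polar Q g x = α → ∃! t : K, Q (x + t • g) = 0) :
    Fintype.card K * #{x | Q x = 0 ∧ QuadraticMap.polar Q g x = α} =
      #{x | QuadraticMap.polar Q g x = α} := by
  have hpol (x : V) (t : K) :
      QuadraticMap.polar Q g (x + t • g) = QuadraticMap.polar Q g x := by
    rw [QuadraticMap.polar_add_right, QuadraticMap.polar_smul_right, hgg, smul_zero, add_zero]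
  have hcount (x : V) :
      (∑ t : K, if Q (x + t • g) = 0 ∧ QuadraticMap.polar Q g (x + t • g) = α then 1 else 0) =
        if QuadraticMap.polar Q g x = α then 1 else 0 := by
    simp only [hpol]
    split_ifs with hx
    · obtain ⟨t, ht, htu⟩ := huniq x hx
      rw [Finset.sum_eq_single t]
      · simp [ht, hx]
      · intro s _ hs
        exact if_neg fun hc => hs (htu s hc.1)
      · simp
    · simp [hx]
  have htrans (t : K) :
      (∑ x : V, if Q (x + t • g) = 0 ∧ QuadraticMap.polar Q g (x + t • g) = α then 1 else 0) =
        #{x | Q x = 0 ∧ QuadraticMap.polar Q g x = α} := by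
    rw [Finset.card_filter]
    exact Fintype.sum_equiv (Equiv.addRight (t • g)) _ _ fun x => rfl
  rw [Finset.card_filter (fun x => QuadraticMap.polar Q g x = α)]
  simp only [← hcount]
  rw [Finset.sum_comm]
  simp only [htrans, sum_const, smul_eq_mul, card_univ]

omit [Fintype K] in
lemma card_singular_polar_eq_of_ne_zero (Q : QuadraticForm K V) (g : V) {α : K} (hα : α ≠ 0) :
    #{x | Q x = 0 ∧ QuadraticMap.polar Q g x = α} =
      #{x | Q x = 0 ∧ QuadraticMap.polar Q g x = 1} := by
  refine Finset.card_bij' (fun x _ => α⁻¹ • x) (fun x _ => α • x) ?_ ?_ ?_ ?_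
  · intro x hx
    simp only [mem_filter, mem_univ, true_and] at hx ⊢
    simp [QuadraticMap.map_smul, QuadraticMap.polar_smul_right, hx, hα]
  · intro x hx
    simp only [mem_filter, mem_univ, true_and] at hx ⊢
    simp [QuadraticMap.map_smul, QuadraticMap.polar_smul_right, hx]
  · intro x _
    simp [smul_smul, hα]
  · intro x _
    simp [smul_smul, hα]

lemma card_singular_eq_add_mul (Q : QuadraticForm K V) (g : V) {α : K} (hα : α ≠ 0) :
    (#{x | Q x = 0} : ℤ) = #{x | Q x = 0 ∧ QuadraticMap.polar Q g x = 0} +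
      (Fintype.card K - 1) * #{x | Q x = 0 ∧ QuadraticMap.polar Q g x = α} := by
  have h1 := Finset.card_eq_sum_card_fiberwise (f := fun x => QuadraticMap.polar Q g x)
    (s := ({x | Q x = 0} : Finset V)) (t := univ) (by simp)
  simp only [Finset.filter_filter] at h1
  rw [← Finset.add_sum_erase _ _ (mem_univ (0 : K)), Finset.sum_congr rfl (fun β hβ => by
    rw [card_singular_polar_eq_of_ne_zero Q g (Finset.ne_of_mem_erase hβ),
      ← card_singular_polar_eq_of_ne_zero Q g hα])] at h1
  rw [h1, sum_const, card_erase_of_mem (mem_univ _), card_univ]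
  have : 1 ≤ Fintype.card K := Fintype.card_pos
  push_cast [this]
  simp [this]

variable [CharP K 2]

omit [Fintype K] [DecidableEq K] [Fintype V] in
lemma polar_self_of_char_two (Q : QuadraticForm K V) (g : V) : QuadraticMap.polar Q g g = 0 := by
  rw [QuadraticMap.polar_self, two_smul, CharTwo.add_self_eq_zero]

omit [Fintype K] [DecidableEq K] [Fintype V] [CharP K 2] in
lemma map_add_smul_apply (Q : QuadraticForm K V) (g x : V) (t : K) :
    Q (x + t • g) = Q x + t ^ 2 * Q g + t * QuadraticMap.polar Q g x := by
  rw [QuadraticMap.map_add Q, QuadraticMap.map_smul, QuadraticMap.polar_smul_right,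
    QuadraticMap.polar_comm]
  simp only [smul_eq_mul]
  ring

lemma card_sq_mul_card_singular_of_singular (Q : QuadraticForm K V) {g : V}
    (hg : QuadraticMap.polarBilin Q g ≠ 0) (hQ : Q g = 0) {α : K} (hα : α ≠ 0) :
    Fintype.card K * (Fintype.card K * #{x | Q x = 0 ∧ QuadraticMap.polar Q g x = α}) =
      Fintype.card V := by
  rw [card_mul_card_singular_of_line Q g α (polar_self_of_char_two Q g)]
  · exact card_mul_card_fiber_of_linear (QuadraticMap.polarBilin Q g) hg α
  · intro x hx
    simp only [map_add_smul_apply, hx, hQ]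
    refine ⟨Q x / α, ?_, fun t ht => ?_⟩
    · change Q x + (Q x / α) ^ 2 * 0 + Q x / α * α = 0
      rw [div_mul_cancel₀ _ hα, mul_zero, add_zero, CharTwo.add_self_eq_zero]
    · field_simp
      linear_combination ht - Q x * CharTwo.two_eq_zero (R := K)

lemma card_sq_mul_card_singular_orthogonal (Q : QuadraticForm K V) {g : V}
    (hg : QuadraticMap.polarBilin Q g ≠ 0) (hQ : Q g ≠ 0) :
    Fintype.card K * (Fintype.card K * #{x | Q x = 0 ∧ QuadraticMap.polar Q g x = 0}) =
      Fintype.card V := by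
  rw [card_mul_card_singular_of_line Q g 0 (polar_self_of_char_two Q g)]
  · exact card_mul_card_fiber_of_linear (QuadraticMap.polarBilin Q g) hg 0
  · intro x hx
    simp only [map_add_smul_apply, hx]
    obtain ⟨s, hs : s ^ 2 = Q x / Q g⟩ :=
      (PerfectRing.bijective_frobenius (R := K) (p := 2)).2 (Q x / Q g)
    refine ⟨s, ?_, fun t ht => ?_⟩
    · simp only [hs]
      field_simp
      linear_combination Q x * CharTwo.two_eq_zero (R := K)
    · apply (PerfectRing.bijective_frobenius (R := K) (p := 2)).1
      change t ^ 2 = s ^ 2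
      rw [hs]
      field_simp
      linear_combination ht - Q x * CharTwo.two_eq_zero (R := K)

/-- The number of singular vectors in terms of the Gauss sum of the form. -/
lemma card_mul_card_singular (Q : QuadraticForm K V) {ψ : AddChar K ℤ} (hψ : ψ ≠ 1) :
    (Fintype.card K : ℤ) * #{x | Q x = 0} =
      Fintype.card V + (Fintype.card K - 1) * ∑ x, ψ (Q x) := by
  have h1 : ∑ x, ∑ c, ψ (c * Q x) = (Fintype.card K : ℤ) * #{x | Q x = 0} := by
    simp only [AddChar.sum_mulShift _ (AddChar.IsPrimitive.of_ne_one hψ)]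
    rw [Finset.card_filter]
    push_cast
    rw [Finset.mul_sum]
    refine Finset.sum_congr rfl fun x _ => ?_
    split_ifs <;> simp
  have h2 (c : K) (hc : c ≠ 0) : ∑ x, ψ (c * Q x) = ∑ x, ψ (Q x) := by
    obtain ⟨b, hb : b ^ 2 = c⟩ := (PerfectRing.bijective_frobenius (R := K) (p := 2)).2 c
    have hb0 : b ≠ 0 := by
      rintro rfl
      exact hc (by simpa using hb.symm)
    refine Fintype.sum_equiv (LinearEquiv.smulOfNeZero K V b hb0).toEquiv _ _ fun x => ?_
    simp [QuadraticMap.map_smul, ← hb, sq]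
  rw [← h1, Finset.sum_comm, ← Finset.add_sum_erase _ _ (mem_univ (0 : K)),
    Finset.sum_congr rfl (fun c hc => h2 c (Finset.ne_of_mem_erase hc)), sum_const,
    card_erase_of_mem (mem_univ _), card_univ]
  have : 1 ≤ Fintype.card K := Fintype.card_pos
  simp [this]

end QuadraticFormCounting

section TraceCharacter

variable {h : ℕ}

lemma tr_add (x y : GaloisField 2 h) : tr h (x + y) = tr h x + tr h y := map_add _ x y

lemma tr_sq (x : GaloisField 2 h) : tr h (x ^ 2) = tr h x := by
  have := Algebra.trace_eq_of_algEquiv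
    (FiniteField.frobeniusAlgEquivOfAlgebraic (ZMod 2) (GaloisField 2 h)) x
  simpa [tr, ZMod.card] using! this

/-- The additive character `x ↦ (-1) ^ Tr x`. -/
noncomputable def trChar (h : ℕ) : AddChar (GaloisField 2 h) ℤ where
  toFun x := if tr h x = 0 then 1 else -1
  map_zero_eq_one' := by simp [tr]
  map_add_eq_mul' x y := by
    rw [tr_add]
    generalize tr h x = a
    generalize tr h y = b
    revert a b
    decide

lemma trChar_apply (x : GaloisField 2 h) : trChar h x = if tr h x = 0 then 1 else -1 := rfl

lemma trChar_sq (x : GaloisField 2 h) : trChar h (x ^ 2) = trChar h x := by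
  rw [trChar_apply, trChar_apply, tr_sq]

lemma trChar_ne_one : trChar h ≠ 1 := by
  obtain ⟨x, hx⟩ := Algebra.trace_surjective (ZMod 2) (GaloisField 2 h) 1
  refine AddChar.ne_one_iff.2 ⟨x, ?_⟩
  have : tr h x = 1 := hx
  rw [trChar_apply, this]
  decide

lemma exists_sq_add_self_eq {c : GaloisField 2 h} (hc : tr h c = 0) :
    ∃ z : GaloisField 2 h, z ^ 2 + z = c := by
  let f : GaloisField 2 h →ₗ[ZMod 2] GaloisField 2 h :=
    (FiniteField.frobeniusAlgHom (ZMod 2) (GaloisField 2 h)).toLinearMap + LinearMap.id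
  have hf (z : GaloisField 2 h) : f z = z ^ 2 + z := by simp [f, ZMod.card]
  have hle : LinearMap.range f ≤ LinearMap.ker (Algebra.trace (ZMod 2) (GaloisField 2 h)) := by
    rintro _ ⟨z, rfl⟩
    change tr h (f z) = 0
    rw [hf, tr_add, tr_sq, CharTwo.add_self_eq_zero]
  have hker : Module.finrank (ZMod 2) (LinearMap.ker f) ≤ 1 := by
    refine finrank_le_one (⟨1, by simp [hf, CharTwo.add_self_eq_zero]⟩ : LinearMap.ker f) ?_
    rintro ⟨w, hw⟩
    rw [LinearMap.mem_ker, hf] at hw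
    have hw' : w * (w + 1) = 0 := by linear_combination hw
    rcases mul_eq_zero.1 hw' with h0 | h1
    · exact ⟨0, by ext; simp [h0]⟩
    · exact ⟨1, by ext; simp [CharTwo.add_eq_zero.1 h1]⟩
  have h1 := LinearMap.finrank_range_add_finrank_ker f
  have h2 := LinearMap.finrank_range_add_finrank_ker (Algebra.trace (ZMod 2) (GaloisField 2 h))
  rw [LinearMap.range_eq_top.2 (Algebra.trace_surjective _ _), finrank_top,
    Module.finrank_self] at h2
  have heq := Submodule.eq_of_le_of_finrank_le hle (by omega)
  have hmem : c ∈ LinearMap.range f := by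
    rw [heq]
    exact hc
  obtain ⟨z, hz⟩ := hmem
  exact ⟨z, by rw [← hf, hz]⟩

end TraceCharacter

section Forms

variable {h m : ℕ}

lemma symp_add_right (u v w : Fin (2*m) → GaloisField 2 h) :
    symp h m u (v + w) = symp h m u v + symp h m u w := by
  simp only [symp, Pi.add_apply, ← Finset.sum_add_distrib]
  exact Finset.sum_congr rfl fun i _ => by ring

lemma symp_comm (u v : Fin (2*m) → GaloisField 2 h) : symp h m u v = symp h m v u :=
  Finset.sum_congr rfl fun i _ => by ring

lemma symp_add_left (u v w : Fin (2*m) → GaloisField 2 h) :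
    symp h m (u + v) w = symp h m u w + symp h m v w := by
  rw [symp_comm, symp_add_right, symp_comm w u, symp_comm w v]

lemma symp_smul_right (c : GaloisField 2 h) (u v : Fin (2*m) → GaloisField 2 h) :
    symp h m u (c • v) = c * symp h m u v := by
  simp only [symp, Pi.smul_apply, smul_eq_mul, Finset.mul_sum]
  exact Finset.sum_congr rfl fun i _ => by ring

lemma symp_self (u : Fin (2*m) → GaloisField 2 h) : symp h m u u = 0 :=
  Finset.sum_eq_zero fun i _ => by rw [mul_comm, CharTwo.add_self_eq_zero]

lemma th0_add (u v : Fin (2*m) → GaloisField 2 h) :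
    th0 h m (u + v) = th0 h m u + th0 h m v + symp h m u v := by
  simp only [th0, symp, Pi.add_apply, ← Finset.sum_add_distrib]
  exact Finset.sum_congr rfl fun i _ => by ring

lemma th_add_right (d u v : Fin (2*m) → GaloisField 2 h) :
    th h m d (u + v) = th h m d u + th h m d v + symp h m u v := by
  rw [th, th, th, th0_add, symp_add_right, CharTwo.add_sq]
  ring

lemma th_add_left (d a u : Fin (2*m) → GaloisField 2 h) :
    th h m (d + a) u = th h m d u + symp h m a u ^ 2 := by
  rw [th, th, symp_add_left, CharTwo.add_sq]
  ring

lemma th_smul (d u : Fin (2*m) → GaloisField 2 h) (c : GaloisField 2 h) :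
    th h m d (c • u) = c * c * th h m d u := by
  have : th0 h m (c • u) = c * c * th0 h m u := by
    simp only [th0, Pi.smul_apply, smul_eq_mul, Finset.mul_sum]
    exact Finset.sum_congr rfl fun i _ => by ring
  rw [th, th, this, symp_smul_right]
  ring

lemma polar_th (d u v : Fin (2*m) → GaloisField 2 h) :
    QuadraticMap.polar (th h m d) u v = symp h m u v := by
  rw [QuadraticMap.polar, th_add_right]
  ring

/-- The quadratic form `ϑ_d`, bundled. -/
noncomputable def thForm (h m : ℕ) (d : Fin (2*m) → GaloisField 2 h) :
    QuadraticForm (GaloisField 2 h) (Fin (2*m) → GaloisField 2 h) :=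
  QuadraticMap.ofPolar (th h m d) (fun c u => th_smul d u c)
    (fun u v w => by simp only [polar_th, symp_add_left])
    (fun c u v => by
      simp only [polar_th, symp_comm _ v, symp_smul_right, smul_eq_mul])

@[simp]
lemma thForm_apply (d u : Fin (2*m) → GaloisField 2 h) : thForm h m d u = th h m d u := rfl

@[simp]
lemma polar_thForm (d u v : Fin (2*m) → GaloisField 2 h) :
    QuadraticMap.polar (thForm h m d) u v = symp h m u v := polar_th d u v

lemma polarBilin_thForm_ne_zero (d : Fin (2*m) → GaloisField 2 h)
    {g : Fin (2*m) → GaloisField 2 h} (hg : g ≠ 0) :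
    QuadraticMap.polarBilin (thForm h m d) g ≠ 0 := by
  intro h0
  have hs (v : Fin (2*m) → GaloisField 2 h) : symp h m g v = 0 := by
    rw [← polar_thForm d]
    exact LinearMap.congr_fun h0 v
  refine hg (funext fun j => ?_)
  by_cases hj : j.1 < m
  · have := hs (Pi.single ⟨m + j.1, by omega⟩ 1)
    rw [symp, Finset.sum_eq_single ⟨j.1, hj⟩] at this
    · have hm0 : ¬ m = 0 := by omega
      simpa [Pi.single_apply, Fin.ext_iff, hm0] using this
    · intro i _ hi
      have h1 : ¬ i.1 = m + j.1 := by omega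
      have h2 : ¬ i.1 = j.1 := fun hc => hi (Fin.ext hc)
      simp [h1, h2]
    · simp
  · have := hs (Pi.single ⟨j.1 - m, by omega⟩ 1)
    rw [symp, Finset.sum_eq_single ⟨j.1 - m, by omega⟩] at this
    · have hne : ¬ j.1 = j.1 - m := by omega
      have hje : m + (j.1 - m) = j.1 := by omega
      simpa [Pi.single_apply, Fin.ext_iff, hne, hje] using this
    · intro i _ hi
      have h1 : ¬ m + i.1 = j.1 - m := by omega
      have h2 : ¬ i.1 = j.1 - m := fun hc => hi (Fin.ext hc)
      simp [h1, h2]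
    · simp

/-- Splitting `F^{2m}` into the `m` hyperbolic pairs of coordinates. -/
def pairEquiv (K : Type*) (m : ℕ) : (Fin (2*m) → K) ≃ (Fin m → K × K) where
  toFun x i := (x ⟨i.1, by omega⟩, x ⟨m + i.1, by omega⟩)
  invFun y j := if hj : j.1 < m then (y ⟨j.1, hj⟩).1 else (y ⟨j.1 - m, by omega⟩).2
  left_inv x := by
    funext j
    by_cases hj : j.1 < m
    · simp [hj]
    · have hje : m + (j.1 - m) = j.1 := by omega
      simp [hj, hje]
  right_inv y := by
    funext i
    simp

variable [Fintype (GaloisField 2 h)]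

lemma sum_trChar_th0 :
    ∑ x, trChar h (th0 h m x) = (Fintype.card (GaloisField 2 h) : ℤ) ^ m := by
  classical
  have hpair : ∑ p : GaloisField 2 h × GaloisField 2 h, trChar h (p.1 * p.2) =
      (Fintype.card (GaloisField 2 h) : ℤ) := by
    rw [Fintype.sum_prod_type_right]
    simp [AddChar.sum_mulShift _ (AddChar.IsPrimitive.of_ne_one (trChar_ne_one (h := h)))]
  calc ∑ x, trChar h (th0 h m x)
      = ∑ y : Fin m → GaloisField 2 h × GaloisField 2 h,
          ∏ i, trChar h ((y i).1 * (y i).2) := by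
        refine Fintype.sum_equiv (pairEquiv _ m) _ _ fun x => ?_
        rw [th0]
        exact map_prod (trChar h).toMonoidHom
          (fun i : Fin m => Multiplicative.ofAdd (x ⟨i.1, by omega⟩ * x ⟨m + i.1, by omega⟩)) univ
    _ = ∏ _i : Fin m, ∑ p : GaloisField 2 h × GaloisField 2 h, trChar h (p.1 * p.2) := by
        rw [Finset.prod_univ_sum, Fintype.piFinset_univ]
    _ = _ := by rw [hpair]; simp

lemma sum_trChar_th (d : Fin (2*m) → GaloisField 2 h) :
    ∑ x, trChar h (th h m d x) =
      trChar h (th0 h m d) * (Fintype.card (GaloisField 2 h) : ℤ) ^ m := by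
  rw [← sum_trChar_th0, Finset.mul_sum]
  refine Fintype.sum_equiv (Equiv.addRight d) _ _ fun x => ?_
  rw [th, AddChar.map_add_eq_mul, trChar_sq, ← AddChar.map_add_eq_mul, ← AddChar.map_add_eq_mul,
    Equiv.coe_addRight, th0_add, symp_comm x d]
  congr 1
  linear_combination -th0 h m d * CharTwo.two_eq_zero (R := GaloisField 2 h)

variable [DecidableEq (GaloisField 2 h)]

lemma card_mul_card_singular_th (e : Fin (2*m) → GaloisField 2 h) :
    (Fintype.card (GaloisField 2 h) : ℤ) * #{x | th h m e x = 0} =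
      (Fintype.card (GaloisField 2 h) : ℤ) ^ (2 * m) + (Fintype.card (GaloisField 2 h) - 1) *
        (trChar h (th0 h m e) * (Fintype.card (GaloisField 2 h) : ℤ) ^ m) := by
  have hgauss : (Fintype.card (GaloisField 2 h) : ℤ) * #{x | th h m e x = 0} =
      Fintype.card (Fin (2*m) → GaloisField 2 h) +
        (Fintype.card (GaloisField 2 h) - 1) * ∑ x, trChar h (th h m e x) :=
    card_mul_card_singular (thForm h m e) trChar_ne_one
  rw [hgauss, sum_trChar_th]
  simp

lemma card_singular_th (k : ℕ) (e : Fin (2*(k+1)) → GaloisField 2 h) :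
    (#{x | th h (k+1) e x = 0} : ℤ) =
      Fintype.card (GaloisField 2 h) * ((Fintype.card (GaloisField 2 h) : ℤ) ^ k) ^ 2 +
        (Fintype.card (GaloisField 2 h) - 1) *
          (trChar h (th0 h (k+1) e) * (Fintype.card (GaloisField 2 h) : ℤ) ^ k) := by
  have hq : (Fintype.card (GaloisField 2 h) : ℤ) ≠ 0 := by exact_mod_cast Fintype.card_ne_zero
  apply mul_left_cancel₀ hq
  rw [card_mul_card_singular_th]
  ring

lemma card_singular_th_eq_add_mul (e g : Fin (2*m) → GaloisField 2 h) {α : GaloisField 2 h}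
    (hα : α ≠ 0) :
    (#{x | th h m e x = 0} : ℤ) = #{x | th h m e x = 0 ∧ symp h m g x = 0} +
      (Fintype.card (GaloisField 2 h) - 1) *
        #{x | th h m e x = 0 ∧ symp h m g x = α} := by
  have hsplit := card_singular_eq_add_mul (thForm h m e) g hα
  simp only [polar_thForm] at hsplit
  exact hsplit

omit [Fintype (GaloisField 2 h)] in
lemma card_sq_add_self_eq {V : Type*} [Fintype V] (p : V → Prop) [DecidablePred p]
    (f : V → GaloisField 2 h) (α : GaloisField 2 h) :
    #{x | p x ∧ f x ^ 2 + f x = α ^ 2 + α} =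
      #{x | p x ∧ f x = α} + #{x | p x ∧ f x = α + 1} := by
  classical
  have hiff (z : GaloisField 2 h) : z ^ 2 + z = α ^ 2 + α ↔ z = α ∨ z = α + 1 := by
    have h2 := CharTwo.two_eq_zero (R := GaloisField 2 h)
    constructor
    · intro hz
      have : (z - α) * (z - (α + 1)) = 0 := by
        linear_combination hz + (α ^ 2 + α - z - α * z) * h2
      rcases mul_eq_zero.1 this with h0 | h0
      · exact Or.inl (sub_eq_zero.1 h0)
      · exact Or.inr (sub_eq_zero.1 h0)
    · rintro (rfl | rfl)
      · rfl
      · linear_combination (α + 1) * h2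
  rw [← Finset.card_union_of_disjoint]
  · congr 1
    ext x
    simp only [mem_filter, mem_univ, true_and, mem_union, hiff]
    tauto
  · rw [Finset.disjoint_filter]
    rintro x - ⟨-, hx⟩ ⟨-, hx'⟩
    rw [hx] at hx'
    simp at hx'

lemma card_common_of_singular (k : ℕ) (e : Fin (2*(k+1)) → GaloisField 2 h)
    {g : Fin (2*(k+1)) → GaloisField 2 h} (hg : g ≠ 0) (hQ : th h (k+1) e g = 0) :
    (#{x | th h (k+1) e x = 0 ∧ symp h (k+1) g x ^ 2 + symp h (k+1) g x = 0} : ℤ) =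
      2 * ((Fintype.card (GaloisField 2 h) : ℤ) ^ k) ^ 2 + trChar h (th0 h (k+1) e) *
        (Fintype.card (GaloisField 2 h) : ℤ) ^ k * (Fintype.card (GaloisField 2 h) - 1) := by
  have hq : (Fintype.card (GaloisField 2 h) : ℤ) ≠ 0 := by exact_mod_cast Fintype.card_ne_zero
  have hsplit := card_sq_add_self_eq (fun x => th h (k+1) e x = 0)
    (fun x => symp h (k+1) g x) 0
  have hone := card_sq_mul_card_singular_of_singular (thForm h (k+1) e)
    (polarBilin_thForm_ne_zero e hg) hQ one_ne_zero
  have htotal := card_singular_th_eq_add_mul e g one_ne_zero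
  simp only [thForm_apply, polar_thForm, Fintype.card_fun, Fintype.card_fin]
    at hone
  simp only [zero_add, ne_eq, OfNat.ofNat_ne_zero, not_false_eq_true, zero_pow, add_zero]
    at hsplit
  rw [hsplit]
  zify at hone
  push_cast
  have hone' : (#{x | th h (k+1) e x = 0 ∧ symp h (k+1) g x = 1} : ℤ) =
      ((Fintype.card (GaloisField 2 h) : ℤ) ^ k) ^ 2 := by
    apply mul_left_cancel₀ hq
    apply mul_left_cancel₀ hq
    rw [hone]
    ring
  rw [card_singular_th, hone'] at htotal
  rw [hone']
  linear_combination -htotal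

lemma card_common_of_nonsingular (k : ℕ) (e : Fin (2*(k+1)) → GaloisField 2 h)
    {g : Fin (2*(k+1)) → GaloisField 2 h} (hQ : th h (k+1) e g ≠ 0)
    (htr : tr h (th h (k+1) e g) = 0) :
    (#{x | th h (k+1) e x = 0 ∧
        symp h (k+1) g x ^ 2 + symp h (k+1) g x = th h (k+1) e g} : ℤ) =
      2 * (Fintype.card (GaloisField 2 h) : ℤ) ^ k *
        ((Fintype.card (GaloisField 2 h) : ℤ) ^ k + trChar h (th0 h (k+1) e)) := by
  have hq : (Fintype.card (GaloisField 2 h) : ℤ) ≠ 0 := by exact_mod_cast Fintype.card_ne_zero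
  have hq1 : (Fintype.card (GaloisField 2 h) : ℤ) - 1 ≠ 0 := by
    have : 1 < Fintype.card (GaloisField 2 h) := Fintype.one_lt_card
    omega
  have hg : g ≠ 0 := by
    rintro rfl
    exact hQ (map_zero (thForm h (k+1) e))
  obtain ⟨α, hα⟩ := exists_sq_add_self_eq htr
  have hα0 : α ≠ 0 := by
    rintro rfl
    exact hQ (by simpa using hα.symm)
  have hα1 : α + 1 ≠ 0 := by
    intro hc
    exact hQ (by linear_combination -hα + α * hc)
  have hzero := card_sq_mul_card_singular_orthogonal (thForm h (k+1) e)
    (polarBilin_thForm_ne_zero e hg) hQ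
  simp only [thForm_apply, polar_thForm, Fintype.card_fun, Fintype.card_fin] at hzero
  zify at hzero
  have hzero' : (#{x | th h (k+1) e x = 0 ∧ symp h (k+1) g x = 0} : ℤ) =
      ((Fintype.card (GaloisField 2 h) : ℤ) ^ k) ^ 2 := by
    apply mul_left_cancel₀ hq
    apply mul_left_cancel₀ hq
    rw [hzero]
    ring
  have hfib {β : GaloisField 2 h} (hβ : β ≠ 0) :
      (#{x | th h (k+1) e x = 0 ∧ symp h (k+1) g x = β} : ℤ) =
        ((Fintype.card (GaloisField 2 h) : ℤ) ^ k) ^ 2 +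
          trChar h (th0 h (k+1) e) * (Fintype.card (GaloisField 2 h) : ℤ) ^ k := by
    have htotal := card_singular_th_eq_add_mul e g hβ
    rw [card_singular_th, hzero'] at htotal
    apply mul_left_cancel₀ hq1
    linear_combination -htotal
  rw [← hα, card_sq_add_self_eq (fun x => th h (k+1) e x = 0) (fun x => symp h (k+1) g x) α]
  push_cast
  rw [hfib hα0, hfib hα1]
  ring

end Forms

section Graph

variable {h m : ℕ}

lemma add_self_coord (a : Fin (2*m) → GaloisField 2 h) : a + a = 0 :=
  funext fun _ => CharTwo.add_self_eq_zero _

lemma add_add_cancel_coord (a x : Fin (2*m) → GaloisField 2 h) : a + (a + x) = x := by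
  rw [← add_assoc, add_self_coord, zero_add]

lemma add_eq_zero_iff_coord {a b : Fin (2*m) → GaloisField 2 h} : a + b = 0 ↔ a = b := by
  rw [← add_self_coord a, add_right_inj, eq_comm]

lemma th_add_eq_sq_iff (d a b : Fin (2*m) → GaloisField 2 h) :
    th h m d (a + b) = symp h m a b ^ 2 ↔ th h m (d + a) (a + b) = 0 := by
  rw [th_add_left, symp_add_right, symp_self, zero_add, CharTwo.add_eq_zero]

lemma th_add_left_add_right (d a b x : Fin (2*m) → GaloisField 2 h) :
    th h m (d + b) (a + b + x) = th h m (d + a) x +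
      (symp h m (a + b) x ^ 2 + symp h m (a + b) x) + th h m (d + a) (a + b) := by
  have hs (y : Fin (2*m) → GaloisField 2 h) :
      th h m (d + b) y = th h m (d + a) y + symp h m (a + b) y ^ 2 := by
    rw [← th_add_left, add_assoc d a, add_add_cancel_coord]
  rw [th_add_right, hs, hs, symp_self]
  ring

lemma tr_th_add_of_singular {d a x : Fin (2*m) → GaloisField 2 h}
    (hx : th h m (d + a) x = 0) : tr h (th h m d (a + x)) = tr h (th h m d a) := by
  rw [th_add_left, CharTwo.add_eq_zero] at hx
  rw [th_add_right, hx, tr_add, tr_add, tr_sq, add_assoc, CharTwo.add_self_eq_zero, add_zero]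

lemma tr_th_add_left_add (d a b : Fin (2*m) → GaloisField 2 h) :
    tr h (th h m (d + a) (a + b)) = tr h (th h m d a) + tr h (th h m d b) := by
  rw [th_add_left, symp_add_right, symp_self, zero_add, th_add_right, tr_add, tr_add, tr_add,
    tr_sq, add_assoc, CharTwo.add_self_eq_zero, add_zero]

lemma trChar_th0_add (d a : Fin (2*m) → GaloisField 2 h) :
    trChar h (th0 h m (d + a)) = trChar h (th0 h m d) * trChar h (th h m d a) := by
  rw [th0_add, th, ← AddChar.map_add_eq_mul, AddChar.map_add_eq_mul, AddChar.map_add_eq_mul,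
    AddChar.map_add_eq_mul, AddChar.map_add_eq_mul, trChar_sq, mul_assoc]

/-- Translation by `a` identifies a set of vertices with a set of vectors. -/
lemma card_vertices_eq_of_translate {d a : Fin (2*m) → GaloisField 2 h}
    {R : {b : Fin (2*m) → GaloisField 2 h // tr h (th h m d b) = 1} → Prop}
    {Z : (Fin (2*m) → GaloisField 2 h) → Prop} (hR : ∀ b, R b ↔ Z (a + b.1))
    (hZ : ∀ x, Z x → tr h (th h m d (a + x)) = 1) :
    Nat.card {b // R b} = Nat.card {x // Z x} :=
  Nat.card_congr
    { toFun := fun b => ⟨a + b.1.1, (hR b.1).1 b.2⟩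
      invFun := fun x => ⟨⟨a + x.1, hZ x.1 x.2⟩, (hR _).2 (by
        simpa only [add_add_cancel_coord] using x.2)⟩
      left_inv := fun b => Subtype.ext (Subtype.ext (add_add_cancel_coord a b.1.1))
      right_inv := fun x => Subtype.ext (add_add_cancel_coord a x.1) }

end Graph

/-- The graph `NO^ε(2m+1,q)`: vertices `{a : Tr(ϑ_d(a)) = 1}`, distinct `a, b` adjacent iff
`ϑ_d(a+b) = ⟨a,b⟩²`, is strongly regular with parameters
`(q^m(q^m+ε)/2, (q^{m-1}+ε)(q^m-ε), 2(q^{2m-2}-1)+ε q^{m-1}(q-1), 2q^{m-1}(q^{m-1}+ε))`. -/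
theorem stmt_6 (h m : ℕ) (hh : 1 ≤ h) (hm : 2 ≤ m) (d : Fin (2*m) → GaloisField 2 h) :
    let q : ℤ := 2^h
    let ε : ℤ := if tr h (th0 h m d) = 0 then -1 else 1
    let X := {a : Fin (2*m) → GaloisField 2 h // tr h (th h m d a) = 1}
    let Adj : X → X → Prop := fun a b => a ≠ b ∧ th h m d (a.1 + b.1) = (symp h m a.1 b.1)^2
    -- v
    2 * (Nat.card X : ℤ) = q^m * (q^m + ε)
    -- k
    ∧ (∀ a : X, (Nat.card {b : X // Adj a b} : ℤ) = (q^(m - 1) + ε) * (q^m - ε))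
    -- λ
    ∧ (∀ a b : X, Adj a b →
        (Nat.card {c : X // Adj a c ∧ Adj b c} : ℤ)
          = 2 * (q^(2*m - 2) - 1) + ε * q^(m - 1) * (q - 1))
    -- μ
    ∧ (∀ a b : X, a ≠ b → ¬ Adj a b →
        (Nat.card {c : X // Adj a c ∧ Adj b c} : ℤ) = 2 * q^(m - 1) * (q^(m - 1) + ε)) := by
  classical
  intro q ε X Adj
  obtain ⟨k, rfl⟩ : ∃ k, m = k + 1 := ⟨m - 1, by omega⟩
  let _ : Fintype (GaloisField 2 h) := Fintype.ofFinite _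
  have hcard : (Fintype.card (GaloisField 2 h) : ℤ) = q := by
    rw [← Nat.card_eq_fintype_card, GaloisField.card 2 h (by omega)]
    simp [q]
  have hε : trChar h (th0 h (k+1) d) = -ε := by
    simp only [trChar_apply, ε]
    split_ifs <;> rfl
  have hεa (a : X) : trChar h (th0 h (k+1) (d + a.1)) = ε := by
    rw [trChar_th0_add, hε, trChar_apply (th h (k+1) d a.1), a.2]
    simp
  have hadj (a b : X) : Adj a b ↔ a.1 + b.1 ≠ 0 ∧ th h (k+1) (d + a.1) (a.1 + b.1) = 0 := by
    rw [← th_add_eq_sq_iff, ne_eq, add_eq_zero_iff_coord, ← Subtype.ext_iff]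
  have hcommon (a b : X) : (Nat.card {c : X // Adj a c ∧ Adj b c} : ℤ) =
      #{x | (x ≠ 0 ∧ th h (k+1) (d + a.1) x = 0) ∧ (x ≠ a.1 + b.1 ∧
        symp h (k+1) (a.1 + b.1) x ^ 2 + symp h (k+1) (a.1 + b.1) x =
          th h (k+1) (d + a.1) (a.1 + b.1))} := by
    rw [card_vertices_eq_of_translate (a := a.1) (Z := fun x =>
        (x ≠ 0 ∧ th h (k+1) (d + a.1) x = 0) ∧ (x ≠ a.1 + b.1 ∧
          symp h (k+1) (a.1 + b.1) x ^ 2 + symp h (k+1) (a.1 + b.1) x =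
            th h (k+1) (d + a.1) (a.1 + b.1))),
      Nat.card_eq_fintype_card, Fintype.card_subtype]
    · intro c
      have hbc : b.1 + c.1 = a.1 + b.1 + (a.1 + c.1) := by
        rw [add_add_add_comm, add_self_coord, zero_add]
      rw [hadj, hadj]
      refine and_congr_right fun hac => and_congr ?_ ?_
      · rw [ne_eq, ne_eq, add_eq_zero_iff_coord, add_right_inj, eq_comm]
      · rw [hbc, th_add_left_add_right, hac.2, zero_add, CharTwo.add_eq_zero]
    · rintro x ⟨⟨-, hx⟩, -⟩
      rw [tr_th_add_of_singular hx, a.2]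
  simp only [Nat.add_sub_cancel, show 2 * (k + 1) - 2 = k * 2 by omega, pow_mul]
  refine ⟨?_, fun a => ?_, fun a b hab => ?_, fun a b hne hab => ?_⟩
  · have hsum := sum_trChar_th (h := h) d
    have hval (x : Fin (2*(k+1)) → GaloisField 2 h) : trChar h (th h (k+1) d x) =
        1 - 2 * (if tr h (th h (k+1) d x) = 1 then 1 else 0) := by
      rw [trChar_apply]
      generalize tr h (th h (k+1) d x) = y
      revert y
      decide
    simp only [hval, Finset.sum_sub_distrib, ← Finset.mul_sum, hε, hcard] at hsum
    rw [Nat.card_eq_fintype_card, Fintype.card_subtype, Finset.card_filter]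
    simp only [sum_const, card_univ, Fintype.card_fun, Fintype.card_fin] at hsum
    push_cast at hsum ⊢
    simp only [hcard, nsmul_eq_mul, Nat.cast_pow, mul_one] at hsum
    linear_combination -hsum
  · rw [card_vertices_eq_of_translate (a := a.1)
        (Z := fun x => x ≠ 0 ∧ th h (k+1) (d + a.1) x = 0) (fun b => hadj a b)
        (fun x hx => by rw [tr_th_add_of_singular hx.2, a.2]),
      Nat.card_eq_fintype_card, Fintype.card_subtype]
    have hset : ({x | x ≠ 0 ∧ th h (k+1) (d + a.1) x = 0} : Finset _) =
        ({x | th h (k+1) (d + a.1) x = 0} : Finset _).erase 0 := by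
      ext x
      simp
    have hmem : 0 ∈ ({x | th h (k+1) (d + a.1) x = 0} : Finset _) := by
      simpa using map_zero (thForm h (k+1) (d + a.1))
    rw [hset, Finset.cast_card_erase_of_mem hmem, card_singular_th k (d + a.1), hεa, hcard]
    have hεsq : ε ^ 2 = 1 := by
      simp only [ε]
      split_ifs <;> rfl
    linear_combination hεsq
  · obtain ⟨hg, hQ⟩ := (hadj a b).1 hab
    rw [hcommon, hQ]
    have hset : ({x | (x ≠ 0 ∧ th h (k+1) (d + a.1) x = 0) ∧ (x ≠ a.1 + b.1 ∧
        symp h (k+1) (a.1 + b.1) x ^ 2 + symp h (k+1) (a.1 + b.1) x = 0)} : Finset _) =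
        (({x | th h (k+1) (d + a.1) x = 0 ∧ symp h (k+1) (a.1 + b.1) x ^ 2 +
          symp h (k+1) (a.1 + b.1) x = 0} : Finset _).erase 0).erase (a.1 + b.1) := by
      ext x
      simp only [mem_filter, mem_univ, true_and, mem_erase]
      tauto
    rw [hset, Finset.cast_card_erase_of_mem, Finset.cast_card_erase_of_mem,
      card_common_of_singular k _ hg hQ, hεa, hcard]
    · ring
    · have h0 : th h (k+1) (d + a.1) 0 = 0 := map_zero (thForm h (k+1) (d + a.1))
      have h1 : symp h (k+1) (a.1 + b.1) 0 = 0 := by simp [symp]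
      simp [h0, h1]
    · simp [hg, hQ, symp_self]
  · have hg : a.1 + b.1 ≠ 0 := fun hc => hne (Subtype.ext (add_eq_zero_iff_coord.1 hc))
    have hQ : th h (k+1) (d + a.1) (a.1 + b.1) ≠ 0 := fun hc => hab ((hadj a b).2 ⟨hg, hc⟩)
    have htr : tr h (th h (k+1) (d + a.1) (a.1 + b.1)) = 0 := by
      rw [tr_th_add_left_add, a.2, b.2]
      rfl
    rw [hcommon, ← hcard, ← hεa a, ← card_common_of_nonsingular k _ hQ htr]
    congr 2
    ext x
    simp only [mem_filter, mem_univ, true_and]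
    constructor
    · tauto
    · rintro ⟨hx, hs⟩
      refine ⟨⟨?_, hx⟩, ?_, hs⟩
      · rintro rfl
        exact hQ (by rw [← hs]; simp [symp])
      · rintro rfl
        exact hQ (by rw [← hs]; simp [symp_self])
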